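/- Let H : ℝ^N → ℝ^N be Lipschitz, Λ : ℝ^N → ℝ^m continuous, τ > 0, Ω ⊆ ℝ^m open, c_* ∈ Ω, and let f : ℝ → ℝ^N solve f' = H(f) with f(0) = f_*. Suppose (Ĝ_f, Ĝ) and (Ǧ_f, Ǧ) are two pairs of differentiable maps Ω → ℝ^N, each satisfying the invariance PDE (for every c ∈ Ω, the differential of each map applied to its own coarse vector field v(c) = (1/τ)(Λ(·_f(c)) − Λ(·(c))) equals H evaluated at the map's value), and both satisfying the matching conditions Ĝ(c_*) = Ǧ(c_*) = f_* and Ĝ_f(c_*) = Ǧ_f(c_*) = f(τ). If ĉ, č : I → Ω are differentiable on an interval I containing 0, solve their respective coarse ODEs ĉ'(t) = (1/τ)(Λ(Ĝ_f(ĉ(t))) − Λ(Ĝ(ĉ(t)))) and č'(t) = (1/τ)(Λ(Ǧ_f(č(t))) − Λ(Ǧ(č(t)))), and satisfy ĉ(0) = č(0) = c_*, then ĉ(t) = č(t) for all t ∈ I; i.e., the coarse evolution is independent of which solution pair of the invariance PDE is used. -/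

import Mathlib

/-- Two solutions of a Lipschitz autonomous ODE on an interval that agree at one point of the
interval agree on the whole interval. -/
theorem eqOn_of_hasDerivAt_of_lipschitzWith {E : Type*} [NormedAddCommGroup E] [NormedSpace ℝ E]
    {V : E → E} {K : NNReal} (hV : LipschitzWith K V) {I : Set ℝ} (hI : I.OrdConnected)
    {t₀ : ℝ} (ht₀ : t₀ ∈ I) {u w : ℝ → E} (hu : ∀ t ∈ I, HasDerivAt u (V (u t)) t)
    (hw : ∀ t ∈ I, HasDerivAt w (V (w t)) t) (h₀ : u t₀ = w t₀) : Set.EqOn u w I := by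
  intro t ht
  rcases le_total t₀ t with h | h
  · have hs : Set.Icc t₀ t ⊆ I := hI.out ht₀ ht
    exact ODE_solution_unique (v := fun _ => V) (fun _ => hV)
      (fun x hx => (hu x (hs hx)).continuousAt.continuousWithinAt)
      (fun x hx => (hu x (hs (Set.Ico_subset_Icc_self hx))).hasDerivWithinAt)
      (fun x hx => (hw x (hs hx)).continuousAt.continuousWithinAt)
      (fun x hx => (hw x (hs (Set.Ico_subset_Icc_self hx))).hasDerivWithinAt)
      h₀ (Set.right_mem_Icc.2 h)
  · have hs : Set.Icc t t₀ ⊆ I := hI.out ht ht₀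
    exact ODE_solution_unique_of_mem_Icc_left (v := fun _ => V) (s := fun _ => Set.univ)
      (fun _ _ => hV.lipschitzOnWith)
      (fun x hx => (hu x (hs hx)).continuousAt.continuousWithinAt)
      (fun x hx => (hu x (hs (Set.Ioc_subset_Icc_self hx))).hasDerivWithinAt)
      (fun _ _ => Set.mem_univ _)
      (fun x hx => (hw x (hs hx)).continuousAt.continuousWithinAt)
      (fun x hx => (hw x (hs (Set.Ioc_subset_Icc_self hx))).hasDerivWithinAt)
      (fun _ _ => Set.mem_univ _)
      h₀ (Set.left_mem_Icc.2 h)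

/-- If the differential of `G` maps the vector field `v` to `V ∘ G`, then `G` maps integral curves
of `v` to integral curves of `V`. -/
theorem hasDerivAt_comp_of_fderiv_apply_eq {E F : Type*} [NormedAddCommGroup E] [NormedSpace ℝ E]
    [NormedAddCommGroup F] [NormedSpace ℝ F] {G : E → F} {V : F → F} {v : E → E} {c : ℝ → E}
    {t : ℝ} (hG : DifferentiableAt ℝ G (c t)) (hGv : fderiv ℝ G (c t) (v (c t)) = V (G (c t)))
    (hc : HasDerivAt c (v (c t)) t) : HasDerivAt (fun s => G (c s)) (V (G (c t))) t :=
  hGv ▸ hG.hasFDerivAt.comp_hasDerivAt t hc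

/-- If two pairs `(Ĝ_f, Ĝ)` and `(Ǧ_f, Ǧ)` of differentiable maps on an open
set `Ω` both satisfy the invariance PDE and both satisfy the matching conditions at `c_*`
relative to a fine solution `f` of the Lipschitz ODE `f' = H(f)`, `f(0) = f_*`, then the
solutions `ĉ`, `č` of the two corresponding coarse ODEs with common initial condition
`ĉ(0) = č(0) = c_*` coincide on the interval `I` containing `0`: the coarse evolution is
independent of which solution pair of the invariance PDE is used. -/
theorem coarse_evolution_independent_of_manifold {N m : ℕ}
    (H : (Fin N → ℝ) → (Fin N → ℝ)) (K : NNReal) (hH : LipschitzWith K H)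
    (Λ : (Fin N → ℝ) → (Fin m → ℝ)) (hΛ : Continuous Λ) (τ : ℝ) (hτ : 0 < τ)
    (Ω : Set (Fin m → ℝ)) (hΩ : IsOpen Ω) (cstar : Fin m → ℝ) (hcstarΩ : cstar ∈ Ω)
    (f : ℝ → (Fin N → ℝ)) (fstar : Fin N → ℝ)
    (hf : ∀ t : ℝ, HasDerivAt f (H (f t)) t) (hf0 : f 0 = fstar)
    -- the first pair (Ĝ_f, Ĝ)
    (Ghf Gh : (Fin m → ℝ) → (Fin N → ℝ))
    (hGhfdiff : ∀ c ∈ Ω, DifferentiableAt ℝ Ghf c)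
    (hGhdiff : ∀ c ∈ Ω, DifferentiableAt ℝ Gh c)
    (hPDEhf : ∀ c ∈ Ω, fderiv ℝ Ghf c (τ⁻¹ • (Λ (Ghf c) - Λ (Gh c))) = H (Ghf c))
    (hPDEh : ∀ c ∈ Ω, fderiv ℝ Gh c (τ⁻¹ • (Λ (Ghf c) - Λ (Gh c))) = H (Gh c))
    -- the second pair (Ǧ_f, Ǧ)
    (Gcf Gc : (Fin m → ℝ) → (Fin N → ℝ))
    (hGcfdiff : ∀ c ∈ Ω, DifferentiableAt ℝ Gcf c)
    (hGcdiff : ∀ c ∈ Ω, DifferentiableAt ℝ Gc c)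
    (hPDEcf : ∀ c ∈ Ω, fderiv ℝ Gcf c (τ⁻¹ • (Λ (Gcf c) - Λ (Gc c))) = H (Gcf c))
    (hPDEc : ∀ c ∈ Ω, fderiv ℝ Gc c (τ⁻¹ • (Λ (Gcf c) - Λ (Gc c))) = H (Gc c))
    -- matching conditions
    (hmh : Gh cstar = fstar) (hmhf : Ghf cstar = f τ)
    (hmc : Gc cstar = fstar) (hmcf : Gcf cstar = f τ)
    -- the two coarse trajectories
    (I : Set ℝ) (hI : I.OrdConnected) (h0I : (0 : ℝ) ∈ I)
    (ch cc : ℝ → (Fin m → ℝ))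
    (hchΩ : ∀ t ∈ I, ch t ∈ Ω) (hccΩ : ∀ t ∈ I, cc t ∈ Ω)
    (hch : ∀ t ∈ I, HasDerivAt ch (τ⁻¹ • (Λ (Ghf (ch t)) - Λ (Gh (ch t)))) t)
    (hcc : ∀ t ∈ I, HasDerivAt cc (τ⁻¹ • (Λ (Gcf (cc t)) - Λ (Gc (cc t)))) t)
    (hch0 : ch 0 = cstar) (hcc0 : cc 0 = cstar) :
    ∀ t ∈ I, ch t = cc t := by
  have hfine : ∀ {G : (Fin m → ℝ) → (Fin N → ℝ)} {v : (Fin m → ℝ) → (Fin m → ℝ)}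
      {c : ℝ → (Fin m → ℝ)}, (∀ x ∈ Ω, DifferentiableAt ℝ G x) →
      (∀ x ∈ Ω, fderiv ℝ G x (v x) = H (G x)) → (∀ t ∈ I, c t ∈ Ω) →
      (∀ t ∈ I, HasDerivAt c (v (c t)) t) →
      ∀ t ∈ I, HasDerivAt (fun s => G (c s)) (H (G (c t))) t :=
    fun hG hGv hcΩ hc t ht =>
      hasDerivAt_comp_of_fderiv_apply_eq (hG _ (hcΩ t ht)) (hGv _ (hcΩ t ht)) (hc t ht)
  have hGf : Set.EqOn (fun s => Ghf (ch s)) (fun s => Gcf (cc s)) I :=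
    eqOn_of_hasDerivAt_of_lipschitzWith hH hI h0I
      (hfine (v := fun x => τ⁻¹ • (Λ (Ghf x) - Λ (Gh x))) hGhfdiff hPDEhf hchΩ hch)
      (hfine (v := fun x => τ⁻¹ • (Λ (Gcf x) - Λ (Gc x))) hGcfdiff hPDEcf hccΩ hcc)
      (by simp only [hch0, hcc0, hmhf, hmcf])
  have hG : Set.EqOn (fun s => Gh (ch s)) (fun s => Gc (cc s)) I :=
    eqOn_of_hasDerivAt_of_lipschitzWith hH hI h0I
      (hfine (v := fun x => τ⁻¹ • (Λ (Ghf x) - Λ (Gh x))) hGhdiff hPDEh hchΩ hch)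
      (hfine (v := fun x => τ⁻¹ • (Λ (Gcf x) - Λ (Gc x))) hGcdiff hPDEc hccΩ hcc)
      (by simp only [hch0, hcc0, hmh, hmc])
  have hdiff : Set.EqOn (fun s => ch s - cc s) (fun _ => 0) I := by
    refine eqOn_of_hasDerivAt_of_lipschitzWith (V := fun _ => 0) (LipschitzWith.const 0) hI h0I
      (fun t ht => ?_) (fun t _ => hasDerivAt_const t 0) (by simp only [hch0, hcc0, sub_self])
    have hGft : Ghf (ch t) = Gcf (cc t) := hGf ht
    have hGt : Gh (ch t) = Gc (cc t) := hG ht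
    have h := (hch t ht).sub (hcc t ht)
    rwa [hGft, hGt, sub_self] at h
  exact fun t ht => sub_eq_zero.1 (hdiff ht)
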